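/- Let Σ = {a,b} and let w ∈ Σ* be a nonempty word of length n. Then the state complexity of the language Σ* w Σ* equals n + 1; that is, the minimal DFA recognizing Σ* w Σ* has exactly n + 1 states. -/

import Mathlib

/-- The two-letter alphabet Σ = {a, b}. -/
inductive Letter : Type
  | a : Letter
  | b : Letter
deriving DecidableEq

/-- Extended transition function of a DFA: the action of a word on a state. -/
def run {Q : Type} (δ : Q → Letter → Q) (q : Q) (w : List Letter) : Q :=
  w.foldl δ q

open Classical in
/-- Knuth-Morris-Pratt transition function. -/
noncomputable def kmpStep (w : List Letter) (q : Fin (w.length + 1)) (c : Letter) :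
    Fin (w.length + 1) :=
  if q.val = w.length then q
  else ⟨Nat.findGreatest (fun j => w.take j <:+ w.take q.val ++ [c]) w.length,
    Nat.lt_succ_of_le (Nat.findGreatest_le _)⟩

/-- Invariant of the KMP automaton. -/
def KmpInv (w u : List Letter) (q : ℕ) : Prop :=
  (w <:+: u ∧ q = w.length) ∨
  (¬ w <:+: u ∧ w.take q <:+ u ∧ ∀ j ≤ w.length, w.take j <:+ u → j ≤ q)

theorem kmp_suffix_iff (w u : List Letter) (c : Letter) (k : ℕ)
    (hk : w.take k <:+ u) (hmax : ∀ j ≤ w.length, w.take j <:+ u → j ≤ k)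
    (j : ℕ) (hj : j ≤ w.length) :
    w.take j <:+ u ++ [c] ↔ w.take j <:+ w.take k ++ [c] := by
  constructor
  · intro h
    rw [List.suffix_concat_iff] at h ⊢
    rcases h with h | ⟨t, ht, hs⟩
    · exact Or.inl h
    · refine Or.inr ⟨t, ht, ?_⟩
      have hlen : j = t.length + 1 := by
        have := congrArg List.length ht
        simp at this
        omega
      have ht' : t = w.take t.length := by
        have h1 : (w.take j).take t.length = t := by rw [ht]; simp
        rw [List.take_take, Nat.min_eq_left (by omega)] at h1
        exact h1.symm
      have hle : t.length ≤ k := hmax _ (by omega) (ht' ▸ hs)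
      refine List.suffix_of_suffix_length_le hs hk ?_
      rw [List.length_take]
      omega
  · intro h
    refine h.trans ?_
    obtain ⟨s, rfl⟩ := hk
    exact ⟨s, by simp⟩

theorem kmp_step_inv (w u : List Letter) (c : Letter) (q : Fin (w.length + 1))
    (h : KmpInv w u q) : KmpInv w (u ++ [c]) (kmpStep w q c) := by
  classical
  rcases h with ⟨h, hq⟩ | ⟨h, hs, hmax⟩
  · left
    exact ⟨List.infix_concat_iff.2 (Or.inr h), by simp [kmpStep, hq]⟩
  · have hq : q.val ≠ w.length := by
      intro hq
      rw [hq, List.take_length] at hs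
      exact h hs.isInfix
    have hval : (kmpStep w q c).val =
        Nat.findGreatest (fun j => w.take j <:+ w.take q.val ++ [c]) w.length := by
      simp only [kmpStep, if_neg hq]
    have hmax2 : ∀ j ≤ w.length, w.take j <:+ u ++ [c] → j ≤ (kmpStep w q c).val := by
      intro j hj hj2
      rw [hval]
      exact Nat.le_findGreatest hj ((kmp_suffix_iff w u c q hs hmax j hj).1 hj2)
    by_cases h2 : w <:+: u ++ [c]
    · left
      refine ⟨h2, ?_⟩
      have h3 : w <:+ u ++ [c] := (List.infix_concat_iff.1 h2).resolve_right h
      have := hmax2 w.length le_rfl (by rwa [List.take_length])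
      have := (kmpStep w q c).isLt
      omega
    · right
      refine ⟨h2, ?_, hmax2⟩
      rw [kmp_suffix_iff w u c q hs hmax _ (by have := (kmpStep w q c).isLt; omega), hval]
      exact Nat.findGreatest_spec (P := fun j => w.take j <:+ w.take q.val ++ [c])
        (Nat.zero_le _) (by simp)

theorem kmp_run_inv (w : List Letter) (hw : w ≠ []) (u : List Letter) :
    KmpInv w u (run (kmpStep w) 0 u : Fin (w.length + 1)).val := by
  induction u using List.reverseRecOn with
  | nil =>
    right
    refine ⟨by simpa using hw, by simp [run], ?_⟩
    intro j hj h
    have h1 := congrArg List.length (List.suffix_nil.1 h)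
    simp only [List.length_take, List.length_nil] at h1
    omega
  | append_singleton u c ih =>
    have : run (kmpStep w) 0 (u ++ [c]) = kmpStep w (run (kmpStep w) 0 u) c := by
      simp [run]
    rw [this]
    exact kmp_step_inv w u c _ ih

/-- The state complexity of Σ* w Σ* is |w| + 1: there is a complete DFA with |w| + 1
states recognizing Σ* w Σ*, and every complete DFA recognizing Σ* w Σ* has at least
|w| + 1 states. -/
theorem stmt10 (w : List Letter) (hw : w ≠ []) :
    (∃ (δ : Fin (w.length + 1) → Letter → Fin (w.length + 1))
        (q0 : Fin (w.length + 1)) (F : Set (Fin (w.length + 1))),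
        {u : List Letter | w <:+: u} = {u : List Letter | run δ q0 u ∈ F}) ∧
    (∀ (Q : Type) [Fintype Q], ∀ (δ : Q → Letter → Q) (q0 : Q) (F : Set Q),
        {u : List Letter | w <:+: u} = {u : List Letter | run δ q0 u ∈ F} →
        w.length + 1 ≤ Fintype.card Q) := by
  constructor
  · refine ⟨kmpStep w, 0, {q | q.val = w.length}, ?_⟩
    ext u
    simp only [Set.mem_ofPred_eq]
    rcases kmp_run_inv w hw u with ⟨h, hq⟩ | ⟨h, hs, _⟩
    · exact ⟨fun _ => hq, fun _ => h⟩
    · refine ⟨fun h' => absurd h' h, fun hq => ?_⟩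
      rw [hq, List.take_length] at hs
      exact hs.isInfix
  · intro Q _ δ q0 F hL
    have key : ∀ i j : ℕ, i < j → j ≤ w.length →
        run δ q0 (w.take i) ≠ run δ q0 (w.take j) := by
      intro i j hij hj he
      have h1 : w.take j ++ w.drop j ∈ {u : List Letter | w <:+: u} := by
        simp
      rw [hL] at h1
      have h2 : w.take i ++ w.drop j ∈ {u : List Letter | run δ q0 u ∈ F} := by
        simp only [run, Set.mem_ofPred_eq, List.foldl_append] at h1 he ⊢
        rwa [he]
      rw [← hL] at h2
      have h3 := List.IsInfix.length_le h2
      simp only [List.length_append, List.length_take, List.length_drop] at h3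
      omega
    have hinj : Function.Injective
        (fun i : Fin (w.length + 1) => run δ q0 (w.take i.val)) := by
      intro i j hij
      rcases lt_trichotomy i.val j.val with h | h | h
      · exact absurd hij (key _ _ h (by omega))
      · exact Fin.ext h
      · exact absurd hij.symm (key _ _ h (by omega))
    simpa using Fintype.card_le_of_injective _ hinj
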